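/- Let W : Λ_L → ℝ be supported in a ball of radius ℓL, with |W_p| ≤ C for all p and |W_p| ≤ C/((ℓL)²|p|²) for p ≠ 0 (where W_p = ∫ W(x)e^{-ipx}dx). Then for ε₀ > 0 and k_F > 0 with ℓL = ρ^{-1/3+α₃}, k_F ∼ ρ^{1/3}, ε₀ = ρ^{2/3+ι}, ι > 0, and all q with |q| ≤ k_F: (1/L³)·∑_{p ∉ B_F} |W_{p-q}|/(|p|² - k_F² + ε₀) ≤ C'·ρ^{1/3-α₃}, where B_F = {p ∈ (2π/L)ℤ³ : |p| ≤ k_F} and the sum is over the dual lattice, provided L is large enough. -/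

import Mathlib

/-- The point `(2π/L)·n` of the dual lattice `(2π/L)ℤ³`. -/
noncomputable def latticePt (L : ℝ) (n : Fin 3 → ℤ) : EuclideanSpace ℝ (Fin 3) :=
  (EuclideanSpace.equiv (Fin 3) ℝ).symm fun i => (2 * Real.pi / L) * (n i)

open MeasureTheory Set

@[simp]
lemma latticePt_apply (L : ℝ) (n : Fin 3 → ℤ) (i : Fin 3) :
    latticePt L n i = (2 * Real.pi / L) * (n i) := rfl

lemma latticePt_sub (L : ℝ) (n m : Fin 3 → ℤ) :
    latticePt L (n - m) = latticePt L n - latticePt L m := by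
  ext i
  simp [mul_sub]

/-- The half-open cube of side `2π/L` whose lowest corner is the lattice point `latticePt L n`. -/
def latticeCell (L : ℝ) (n : Fin 3 → ℤ) : Set (EuclideanSpace ℝ (Fin 3)) :=
  WithLp.ofLp ⁻¹' univ.pi fun i =>
    Ico ((2 * Real.pi / L) * (n i)) ((2 * Real.pi / L) * (n i + 1))

lemma mem_latticeCell {L : ℝ} {n : Fin 3 → ℤ} {x : EuclideanSpace ℝ (Fin 3)} :
    x ∈ latticeCell L n ↔
      ∀ i, (2 * Real.pi / L) * (n i) ≤ x i ∧ x i < (2 * Real.pi / L) * (n i + 1) := by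
  simp [latticeCell, Set.mem_pi]

lemma measurableSet_latticeCell (L : ℝ) (n : Fin 3 → ℤ) : MeasurableSet (latticeCell L n) :=
  (PiLp.volume_preserving_ofLp (Fin 3)).measurable
    (MeasurableSet.univ_pi fun _ => measurableSet_Ico)

lemma volume_real_latticeCell {L : ℝ} (hL : 0 < L) (n : Fin 3 → ℤ) :
    volume.real (latticeCell L n) = (2 * Real.pi / L) ^ 3 := by
  have h0 : 0 ≤ 2 * Real.pi / L := by positivity
  rw [Measure.real, latticeCell, (PiLp.volume_preserving_ofLp (Fin 3)).measure_preimage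
    (MeasurableSet.univ_pi fun _ => measurableSet_Ico).nullMeasurableSet, volume_pi_pi]
  simp only [Real.volume_Ico, ← mul_sub, add_sub_cancel_left, mul_one, Finset.prod_const,
    Finset.card_univ, Fintype.card_fin, ENNReal.toReal_pow, ENNReal.toReal_ofReal h0]

lemma disjoint_latticeCell {L : ℝ} (hL : 0 < L) {n m : Fin 3 → ℤ} (hnm : n ≠ m) :
    Disjoint (latticeCell L n) (latticeCell L m) := by
  rw [Set.disjoint_left]
  intro x hn hm
  rw [mem_latticeCell] at hn hm
  refine hnm (funext fun i => ?_)
  have h0 : 0 < 2 * Real.pi / L := by positivity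
  have h1 := lt_of_mul_lt_mul_left ((hn i).1.trans_lt (hm i).2) h0.le
  have h2 := lt_of_mul_lt_mul_left ((hm i).1.trans_lt (hn i).2) h0.le
  have h3 : n i < m i + 1 :=
    Int.cast_lt.1 (h1.trans_eq (by push_cast; rfl) : (n i : ℝ) < (m i + 1 : ℤ))
  have h4 : m i < n i + 1 :=
    Int.cast_lt.1 (h2.trans_eq (by push_cast; rfl) : (m i : ℝ) < (n i + 1 : ℤ))
  omega

lemma norm_sub_latticePt_le {L : ℝ} (hL : 0 < L) {n : Fin 3 → ℤ}
    {x : EuclideanSpace ℝ (Fin 3)} (hx : x ∈ latticeCell L n) :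
    ‖x - latticePt L n‖ ≤ 4 * Real.pi / L := by
  rw [mem_latticeCell] at hx
  have h0 : 0 < 2 * Real.pi / L := by positivity
  have h1 : 4 * Real.pi / L = 2 * (2 * Real.pi / L) := by ring
  rw [h1, EuclideanSpace.norm_eq]
  refine Real.sqrt_le_iff.2 ⟨by positivity, ?_⟩
  have key : ∀ i, ‖(x - latticePt L n) i‖ ^ 2 ≤ (2 * Real.pi / L) ^ 2 := fun i => by
    rw [Real.norm_eq_abs, sq_abs]
    have := hx i
    simp only [PiLp.sub_apply, latticePt_apply]
    exact pow_le_pow_left₀ (by linarith) (by linarith) 2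
  calc ∑ i, ‖(x - latticePt L n) i‖ ^ 2 ≤ ∑ _i : Fin 3, (2 * Real.pi / L) ^ 2 :=
        Finset.sum_le_sum fun i _ => key i
    _ = 3 * (2 * Real.pi / L) ^ 2 := by simp
    _ ≤ (2 * (2 * Real.pi / L)) ^ 2 := by nlinarith [sq_nonneg (2 * Real.pi / L)]

/-- A lattice sum is bounded by a radial integral as soon as each term is bounded by the
corresponding radial function at all points near the lattice point. -/
lemma tsum_latticePt_le_integral {L : ℝ} (hL : 0 < L) {T : (Fin 3 → ℤ) → ℝ} {φ : ℝ → ℝ}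
    (hT : 0 ≤ T) (hφ : ∀ r, 0 ≤ φ r) (hint : IntegrableOn φ (Ioi 0))
    (h : ∀ n (x : EuclideanSpace ℝ (Fin 3)), ‖x - latticePt L n‖ ≤ 4 * Real.pi / L →
      T n ≤ φ ‖x‖ / ‖x‖ ^ 2) :
    (1 / L ^ 3) * ∑' n, T n ≤
      3 * volume.real (Metric.ball (0 : EuclideanSpace ℝ (Fin 3)) 1) / (2 * Real.pi) ^ 3 *
        ∫ r in Ioi (0 : ℝ), φ r := by
  have hcongr : EqOn (fun y : ℝ => y ^ 2 * (φ y / y ^ 2)) φ (Ioi 0) := fun y hy => by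
    have : y ≠ 0 := (mem_Ioi.1 hy).ne'
    simp only
    field_simp
  have hI : Integrable fun x : EuclideanSpace ℝ (Fin 3) => φ ‖x‖ / ‖x‖ ^ 2 := by
    refine (integrable_fun_norm_addHaar volume (f := fun r => φ r / r ^ 2)).2 ?_
    simp only [finrank_euclideanSpace, Fintype.card_fin, smul_eq_mul]
    exact hint.congr_fun hcongr.symm measurableSet_Ioi
  have hpolar : ∫ x : EuclideanSpace ℝ (Fin 3), φ ‖x‖ / ‖x‖ ^ 2 =
      3 * volume.real (Metric.ball (0 : EuclideanSpace ℝ (Fin 3)) 1) *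
        ∫ r in Ioi (0 : ℝ), φ r := by
    rw [integral_fun_norm_addHaar volume (fun r => φ r / r ^ 2)]
    simp only [finrank_euclideanSpace, Fintype.card_fin, smul_eq_mul, nsmul_eq_mul]
    rw [setIntegral_congr_fun measurableSet_Ioi hcongr]
    push_cast
    ring
  have hcube : 0 < (2 * Real.pi / L) ^ 3 := by positivity
  have hsum : ∑' n, T n ≤
      (∫ x : EuclideanSpace ℝ (Fin 3), φ ‖x‖ / ‖x‖ ^ 2) / (2 * Real.pi / L) ^ 3 := by
    refine Real.tsum_le_of_sum_le hT fun s => ?_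
    rw [le_div_iff₀ hcube, Finset.sum_mul]
    calc ∑ n ∈ s, T n * (2 * Real.pi / L) ^ 3
        = ∑ n ∈ s, ∫ _x in latticeCell L n, T n := by
          refine Finset.sum_congr rfl fun n _ => ?_
          rw [setIntegral_const, volume_real_latticeCell hL, smul_eq_mul, mul_comm]
      _ ≤ ∑ n ∈ s, ∫ x in latticeCell L n, φ ‖x‖ / ‖x‖ ^ 2 := by
          refine Finset.sum_le_sum fun n _ => ?_
          refine setIntegral_mono_on (integrableOn_const ?_) hI.integrableOn
            (measurableSet_latticeCell L n) fun x hx => h n x (norm_sub_latticePt_le hL hx)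
          intro htop
          have := volume_real_latticeCell hL n
          rw [Measure.real, htop, ENNReal.toReal_top] at this
          exact hcube.ne this
      _ = ∫ x in ⋃ n ∈ s, latticeCell L n, φ ‖x‖ / ‖x‖ ^ 2 :=
          (integral_biUnion_finset s (fun n _ => measurableSet_latticeCell L n)
            (fun n _ m _ hnm => disjoint_latticeCell hL hnm) fun n _ => hI.integrableOn).symm
      _ ≤ ∫ x : EuclideanSpace ℝ (Fin 3), φ ‖x‖ / ‖x‖ ^ 2 :=
          setIntegral_le_integral hI (Filter.Eventually.of_forall fun x =>
            div_nonneg (hφ _) (sq_nonneg _))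
  calc (1 / L ^ 3) * ∑' n, T n
      ≤ (1 / L ^ 3) *
        ((∫ x : EuclideanSpace ℝ (Fin 3), φ ‖x‖ / ‖x‖ ^ 2) / (2 * Real.pi / L) ^ 3) := by
        gcongr
    _ = _ := by
        rw [hpolar]
        field_simp

/-- A radial majorant of `r² |W| / (p² - k² + ε)` over the points at distance at most `δ` from
the lattice point `p`: the shell around the Fermi surface, the region up to twice the Fermi
radius, the region up to `4R`, and the tail. -/
noncomputable def radialMajorant (k δ ε R r : ℝ) : ℝ :=
  (Ioc (k - δ) (k + δ)).indicator (fun _ => 4 * k ^ 2 / ε) r +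
  (Ioc (k + δ) (2 * k + δ)).indicator (fun r => 16 * k ^ 2 / (k * (r - k - δ) + ε)) r +
  (Ioc 0 (4 * R)).indicator (fun _ => 8) r +
  (Ioi (4 * R)).indicator (fun r => 128 * R ^ 2 * r ^ (-2 : ℝ)) r

lemma radialMajorant_terms_nonneg {k δ ε R : ℝ} (hk : 0 < k) (hε : 0 < ε) (hR : 0 < R) (r : ℝ) :
    0 ≤ (Ioc (k - δ) (k + δ)).indicator (fun _ => 4 * k ^ 2 / ε) r ∧
    0 ≤ (Ioc (k + δ) (2 * k + δ)).indicator
      (fun r => 16 * k ^ 2 / (k * (r - k - δ) + ε)) r ∧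
    0 ≤ (Ioc 0 (4 * R)).indicator (fun _ => (8 : ℝ)) r ∧
    0 ≤ (Ioi (4 * R)).indicator (fun r => 128 * R ^ 2 * r ^ (-2 : ℝ)) r := by
  refine ⟨indicator_nonneg (fun _ _ => by positivity) _, indicator_nonneg (fun s hs => ?_) _,
    indicator_nonneg (fun _ _ => by positivity) _, indicator_nonneg (fun s hs => ?_) _⟩
  · have : 0 < s - k - δ := by linarith [hs.1]
    positivity
  · have : 0 < s := by linarith [mem_Ioi.1 hs]
    positivity

lemma radialMajorant_nonneg {k δ ε R : ℝ} (hk : 0 < k) (hε : 0 < ε) (hR : 0 < R) (r : ℝ) :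
    0 ≤ radialMajorant k δ ε R r := by
  obtain ⟨h1, h2, h3, h4⟩ := radialMajorant_terms_nonneg (δ := δ) hk hε hR r
  unfold radialMajorant
  positivity

lemma integral_radialMajorant {k δ ε R : ℝ} (hk : 0 < k) (hδ : 0 < δ) (hδk : δ ≤ k / 2)
    (hε : 0 < ε) (hR : 0 < R) :
    IntegrableOn (radialMajorant k δ ε R) (Ioi 0) ∧
    ∫ r in Ioi (0 : ℝ), radialMajorant k δ ε R r =
      8 * δ * k ^ 2 / ε + 16 * k * Real.log (1 + k ^ 2 / ε) + 64 * R := by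
  have s1 : Ioc (k - δ) (k + δ) ⊆ Ioi 0 := fun r hr => by
    have := hr.1
    rw [mem_Ioi]
    linarith
  have s2 : Ioc (k + δ) (2 * k + δ) ⊆ Ioi 0 := fun r hr => by
    have := hr.1
    rw [mem_Ioi]
    linarith
  have s3 : Ioc 0 (4 * R) ⊆ Ioi 0 := fun r hr => hr.1
  have s4 : Ioi (4 * R) ⊆ Ioi 0 := Ioi_subset_Ioi (by linarith)
  have hcont : ContinuousOn (fun r => 16 * k ^ 2 / (k * (r - k - δ) + ε))
      (Icc (k + δ) (2 * k + δ)) := by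
    refine ContinuousOn.div (by fun_prop) (by fun_prop) fun r hr => ?_
    have : 0 ≤ r - k - δ := by linarith [hr.1]
    positivity
  have hle : k + δ ≤ 2 * k + δ := by linarith
  have i1 : IntegrableOn ((Ioc (k - δ) (k + δ)).indicator (fun _ => 4 * k ^ 2 / ε)) (Ioi 0) := by
    rw [integrableOn_indicator_iff measurableSet_Ioc, inter_eq_left.2 s1]
    exact integrableOn_const measure_Ioc_lt_top.ne
  have i2 : IntegrableOn ((Ioc (k + δ) (2 * k + δ)).indicator
      (fun r => 16 * k ^ 2 / (k * (r - k - δ) + ε))) (Ioi 0) := by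
    rw [integrableOn_indicator_iff measurableSet_Ioc, inter_eq_left.2 s2]
    exact hcont.integrableOn_Icc.mono_set Ioc_subset_Icc_self
  have i3 : IntegrableOn ((Ioc 0 (4 * R)).indicator (fun _ => (8 : ℝ))) (Ioi 0) := by
    rw [integrableOn_indicator_iff measurableSet_Ioc, inter_eq_left.2 s3]
    exact integrableOn_const measure_Ioc_lt_top.ne
  have i4 : IntegrableOn ((Ioi (4 * R)).indicator (fun r => 128 * R ^ 2 * r ^ (-2 : ℝ)))
      (Ioi 0) := by
    rw [integrableOn_indicator_iff measurableSet_Ioi, inter_eq_left.2 s4]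
    exact (integrableOn_Ioi_rpow_of_lt (by norm_num) (by positivity)).const_mul _
  have e2 : ∫ r in Ioc (k + δ) (2 * k + δ), 16 * k ^ 2 / (k * (r - k - δ) + ε) =
      16 * k * Real.log (1 + k ^ 2 / ε) := by
    rw [← intervalIntegral.integral_of_le hle,
      intervalIntegral.integral_eq_sub_of_hasDerivAt
        (f := fun r => 16 * k * Real.log (k * (r - k - δ) + ε))]
    · rw [← mul_sub, ← Real.log_div]
      · rw [show k * (2 * k + δ - k - δ) + ε = k ^ 2 + ε by ring,
          show k * (k + δ - k - δ) + ε = ε by ring, add_div, div_self hε.ne', add_comm]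
      · have : k * (2 * k + δ - k - δ) + ε = k ^ 2 + ε := by ring
        rw [this]
        positivity
      · have : k * (k + δ - k - δ) + ε = ε := by ring
        rw [this]
        positivity
    · intro r hr
      rw [uIcc_of_le hle] at hr
      have h0 : 0 ≤ r - k - δ := by linarith [hr.1]
      have h1 : k * (r - k - δ) + ε ≠ 0 := by positivity
      have h2 : HasDerivAt (fun r => k * (r - k - δ) + ε) k r := by
        simpa using (((hasDerivAt_id r).sub_const k).sub_const δ).const_mul k |>.add_const ε
      rw [show 16 * k ^ 2 / (k * (r - k - δ) + ε) = 16 * k * (k / (k * (r - k - δ) + ε)) by ring]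
      exact (h2.log h1).const_mul (16 * k)
    · exact ContinuousOn.intervalIntegrable (by rwa [uIcc_of_le hle])
  have e4 : ∫ r in Ioi (4 * R), 128 * R ^ 2 * r ^ (-2 : ℝ) = 32 * R := by
    rw [integral_const_mul, integral_Ioi_rpow_of_lt (by norm_num) (by positivity)]
    norm_num
    rw [Real.rpow_neg_one]
    field_simp
    norm_num1
  refine ⟨((i1.add i2).add i3).add i4, ?_⟩
  rw [show radialMajorant k δ ε R =
      (Ioc (k - δ) (k + δ)).indicator (fun _ => 4 * k ^ 2 / ε) +
      (Ioc (k + δ) (2 * k + δ)).indicator (fun r => 16 * k ^ 2 / (k * (r - k - δ) + ε)) +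
      (Ioc 0 (4 * R)).indicator (fun _ => 8) +
      (Ioi (4 * R)).indicator (fun r => 128 * R ^ 2 * r ^ (-2 : ℝ)) from rfl,
    integral_add' ((i1.add i2).add i3) i4, integral_add' (i1.add i2) i3, integral_add' i1 i2,
    setIntegral_indicator measurableSet_Ioc, setIntegral_indicator measurableSet_Ioc,
    setIntegral_indicator measurableSet_Ioc, setIntegral_indicator measurableSet_Ioi,
    inter_eq_right.2 s1, inter_eq_right.2 s2, inter_eq_right.2 s3, inter_eq_right.2 s4, e2, e4,
    setIntegral_const, setIntegral_const, Real.volume_real_Ioc_of_le (by linarith),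
    Real.volume_real_Ioc_of_le (by linarith)]
  simp only [smul_eq_mul]
  ring

lemma div_le_radialMajorant {k δ ε R C w p r : ℝ} (hk : 0 < k) (hδk : δ ≤ k / 2)
    (hε : 0 < ε) (hR : 0 < R) (hC : 0 ≤ C) (hw0 : 0 ≤ w) (hwC : w ≤ C)
    (hw : 2 * k ≤ p → w ≤ 4 * C * R ^ 2 / p ^ 2) (hp : k < p) (hr : |r - p| ≤ δ) :
    w / (p ^ 2 - k ^ 2 + ε) ≤ C * radialMajorant k δ ε R r / r ^ 2 := by
  obtain ⟨hr1, hr2⟩ := abs_le.1 hr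
  have hr0 : 0 < r := by linarith
  have hδ : 0 ≤ δ := (abs_nonneg _).trans hr
  have hden : 0 < p ^ 2 - k ^ 2 + ε := by nlinarith
  obtain ⟨h1, h2, h3, h4⟩ := radialMajorant_terms_nonneg (δ := δ) hk hε hR r
  suffices hX : ∃ X, X ≤ radialMajorant k δ ε R r ∧ w * r ^ 2 / (p ^ 2 - k ^ 2 + ε) ≤ C * X by
    obtain ⟨X, hX, hwX⟩ := hX
    rw [le_div_iff₀ (by positivity), div_mul_eq_mul_div]
    exact hwX.trans (by gcongr)
  rcases le_or_gt r (k + δ) with hc1 | hc1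
  · refine ⟨4 * k ^ 2 / ε, ?_, ?_⟩
    · unfold radialMajorant
      rw [indicator_of_mem (show r ∈ Ioc (k - δ) (k + δ) from ⟨by linarith, hc1⟩)]
      linarith
    · rw [← mul_div_assoc]
      have : r ^ 2 ≤ 4 * k ^ 2 := by nlinarith
      have : ε ≤ p ^ 2 - k ^ 2 + ε := by nlinarith
      gcongr
  rcases le_or_gt r (2 * k + δ) with hc2 | hc2
  · refine ⟨16 * k ^ 2 / (k * (r - k - δ) + ε), ?_, ?_⟩
    · unfold radialMajorant
      rw [indicator_of_mem (show r ∈ Ioc (k + δ) (2 * k + δ) from ⟨hc1, hc2⟩)]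
      linarith
    · rw [← mul_div_assoc]
      have h5 : r ^ 2 ≤ 16 * k ^ 2 := by nlinarith
      have h6 : 0 < r - k - δ := by linarith
      have h7 : k * (r - k - δ) + ε ≤ p ^ 2 - k ^ 2 + ε := by nlinarith
      gcongr
  have hp2 : 2 * k < p := by linarith
  have hrp : r ≤ 5 / 4 * p := by linarith
  have hrp2 : r ^ 2 ≤ 25 / 16 * p ^ 2 := by nlinarith
  have hdp : 3 / 4 * p ^ 2 ≤ p ^ 2 - k ^ 2 + ε := by nlinarith
  have h8 : w * r ^ 2 / (p ^ 2 - k ^ 2 + ε) ≤ 8 * w := by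
    rw [div_le_iff₀ hden]
    nlinarith
  rcases le_or_gt r (4 * R) with hc3 | hc3
  · refine ⟨8, ?_, by linarith⟩
    unfold radialMajorant
    rw [indicator_of_mem (show r ∈ Ioc 0 (4 * R) from ⟨hr0, hc3⟩)]
    linarith
  · refine ⟨128 * R ^ 2 * r ^ (-2 : ℝ), ?_, ?_⟩
    · unfold radialMajorant
      rw [indicator_of_mem (show r ∈ Ioi (4 * R) from hc3)]
      linarith
    · refine h8.trans ?_
      have hp0 : 0 < p := by linarith
      rw [Real.rpow_neg hr0.le, Real.rpow_two, ← div_eq_mul_inv, ← mul_div_assoc,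
        le_div_iff₀ (by positivity)]
      have h9 : w * p ^ 2 ≤ 4 * C * R ^ 2 := (le_div_iff₀ (by positivity)).1 (hw hp2.le)
      have h10 : 0 ≤ C * R ^ 2 := by positivity
      nlinarith [mul_le_mul_of_nonneg_left hrp2 hw0]

lemma log_one_add_div_le {ρ ι α k : ℝ} (hρ : 0 < ρ) (hρ1 : ρ < 1) (hι : 0 < ι) (hα : 0 < α)
    (hk0 : 0 < k) (hk : k ≤ 2 * ρ ^ ((1 : ℝ) / 3)) :
    Real.log (1 + k ^ 2 / ρ ^ ((2 : ℝ) / 3 + ι)) ≤ 5 ^ (α / ι) / (α / ι) * ρ ^ (-α) := by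
  have h1 : k ^ 2 / ρ ^ ((2 : ℝ) / 3 + ι) ≤ 4 * ρ ^ (-ι) := by
    rw [div_le_iff₀ (by positivity), mul_assoc, ← Real.rpow_add hρ]
    calc k ^ 2 ≤ (2 * ρ ^ ((1 : ℝ) / 3)) ^ 2 := by gcongr
      _ = 4 * ρ ^ (-ι + (2 / 3 + ι)) := by
        rw [mul_pow, ← Real.rpow_natCast (ρ ^ ((1 : ℝ) / 3)), ← Real.rpow_mul hρ.le]
        norm_num
  have h2 : 1 ≤ ρ ^ (-ι) := Real.one_le_rpow_of_pos_of_le_one_of_nonpos hρ hρ1.le (by linarith)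
  calc Real.log (1 + k ^ 2 / ρ ^ ((2 : ℝ) / 3 + ι)) ≤ Real.log (5 * ρ ^ (-ι)) :=
        Real.log_le_log (by positivity) (by linarith)
    _ ≤ (5 * ρ ^ (-ι)) ^ (α / ι) / (α / ι) := Real.log_le_rpow_div (by positivity) (by positivity)
    _ = 5 ^ (α / ι) / (α / ι) * ρ ^ (-α) := by
        rw [Real.mul_rpow (by norm_num) (by positivity), ← Real.rpow_mul hρ.le,
          show -ι * (α / ι) = -α by field_simp]
        ring

/-- Lattice-sum bound: if `|W_p| ≤ C` and `|W_p| ≤ C/((ℓL)²|p|²)` for `p ≠ 0`, with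
`ℓL = ρ^{-1/3+α₃}`, `k_F ∼ ρ^{1/3}`, `ε₀ = ρ^{2/3+ι}`, then for every lattice point `q`
with `|q| ≤ k_F` and `L` large enough,
`(1/L³)∑_{p ∉ B_F} |W_{p-q}|/(|p|² - k_F² + ε₀) ≤ C' ρ^{1/3-α₃}`. -/
theorem stmt12 (C α₃ ι : ℝ) (hC : 0 ≤ C) (hα : 0 < α₃) (hα' : α₃ < 1 / 3) (hι : 0 < ι) :
    ∃ C' : ℝ, 0 < C' ∧ ∃ ρ₀ : ℝ, 0 < ρ₀ ∧
      ∀ ρ : ℝ, 0 < ρ → ρ < ρ₀ →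
        ∃ L₀ : ℝ, ∀ L : ℝ, L₀ ≤ L →
          ∀ kF ℓ : ℝ,
            ρ ^ ((1 : ℝ) / 3) ≤ kF → kF ≤ 2 * ρ ^ ((1 : ℝ) / 3) →
            ℓ * L = ρ ^ (-(1 : ℝ) / 3 + α₃) →
            ∀ W : (Fin 3 → ℤ) → ℂ,
              (∀ n, ‖W n‖ ≤ C) →
              (∀ n, n ≠ 0 → ‖W n‖ ≤ C / ((ℓ * L) ^ 2 * ‖latticePt L n‖ ^ 2)) →
              ∀ m : Fin 3 → ℤ, ‖latticePt L m‖ ≤ kF →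
                (1 / L ^ 3) *
                    ∑' n : Fin 3 → ℤ,
                      (if kF < ‖latticePt L n‖ then
                        ‖W (n - m)‖ /
                          (‖latticePt L n‖ ^ 2 - kF ^ 2 + ρ ^ ((2 : ℝ) / 3 + ι))
                      else 0)
                  ≤ C' * ρ ^ ((1 : ℝ) / 3 - α₃) := by
  set c : ℝ := 3 * volume.real (Metric.ball (0 : EuclideanSpace ℝ (Fin 3)) 1) /
    (2 * Real.pi) ^ 3 with hc
  have hc0 : 0 ≤ c := by positivity
  have hA : (0 : ℝ) < 5 ^ (α₃ / ι) / (α₃ / ι) := by positivity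
  set A : ℝ := 5 ^ (α₃ / ι) / (α₃ / ι) with hAdef
  refine ⟨c * C * (65 + 32 * A) + 1, by positivity, 1, one_pos, fun ρ hρ hρ1 => ?_⟩
  set K : ℝ := ρ ^ ((1 : ℝ) / 3) with hK
  set ε : ℝ := ρ ^ ((2 : ℝ) / 3 + ι) with hε
  set R : ℝ := ρ ^ ((1 : ℝ) / 3 - α₃) with hR
  have hK0 : 0 < K := by positivity
  have hε0 : 0 < ε := by positivity
  have hR0 : 0 < R := by positivity
  have hδ₀ : 0 < min (K / 2) (ε * R / (32 * K ^ 2)) := by positivity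
  set δ₀ : ℝ := min (K / 2) (ε * R / (32 * K ^ 2)) with hδ₀def
  refine ⟨4 * Real.pi / δ₀, fun L hL k ℓ hk1 hk2 hℓ W hW1 hW2 m hm => ?_⟩
  have hL0 : 0 < L := lt_of_lt_of_le (by positivity) hL
  have hδ0 : 0 < 4 * Real.pi / L := by positivity
  have hδle : 4 * Real.pi / L ≤ δ₀ := by
    rw [div_le_iff₀ hL0]
    rw [div_le_iff₀ hδ₀] at hL
    linarith
  set δ : ℝ := 4 * Real.pi / L with hδ
  have hk0 : 0 < k := hK0.trans_le hk1
  have hδk : δ ≤ k / 2 := by linarith [hδle.trans (min_le_left _ _)]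
  obtain ⟨hint, hval⟩ := integral_radialMajorant hk0 hδ0 hδk hε0 hR0
  have hℓR : ℓ * L = R⁻¹ := by
    rw [hℓ, hR, ← Real.rpow_neg hρ.le]
    congr 1
    ring
  have hmain := tsum_latticePt_le_integral hL0
    (T := fun n => if k < ‖latticePt L n‖ then
      ‖W (n - m)‖ / (‖latticePt L n‖ ^ 2 - k ^ 2 + ε) else 0)
    (φ := fun r => C * radialMajorant k δ ε R r) ?_
    (fun r => mul_nonneg hC (radialMajorant_nonneg hk0 hε0 hR0 r)) (hint.const_mul C) ?_
  · refine hmain.trans ?_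
    rw [integral_const_mul, hval, ← hc]
    have hshell : 8 * δ * k ^ 2 / ε ≤ R := by
      have h1 := hδle.trans (min_le_right _ _)
      rw [le_div_iff₀ (by positivity)] at h1
      rw [div_le_iff₀ hε0]
      have h2 : k ^ 2 ≤ 4 * K ^ 2 := by nlinarith
      nlinarith [mul_le_mul_of_nonneg_left h2 hδ0.le]
    have hlog : 16 * k * Real.log (1 + k ^ 2 / ε) ≤ 32 * A * R := by
      have h1 := log_one_add_div_le hρ hρ1 hι hα hk0 hk2
      have h2 : R = K * ρ ^ (-α₃) := by
        rw [hR, hK, ← Real.rpow_add hρ]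
        congr 1
      calc 16 * k * Real.log (1 + k ^ 2 / ε) ≤ 16 * (2 * K) * (A * ρ ^ (-α₃)) := by
            gcongr
            exact Real.log_nonneg (by linarith [show 0 ≤ k ^ 2 / ε by positivity])
        _ = 32 * A * R := by
            rw [h2]
            ring
    calc c * (C * (8 * δ * k ^ 2 / ε + 16 * k * Real.log (1 + k ^ 2 / ε) + 64 * R))
        ≤ c * (C * (R + 32 * A * R + 64 * R)) := by gcongr
      _ ≤ (c * C * (65 + 32 * A) + 1) * R := by linarith
  · intro n
    simp only [Pi.zero_apply]
    split_ifs with h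
    · have : 0 < ‖latticePt L n‖ ^ 2 - k ^ 2 + ε := by nlinarith
      positivity
    · exact le_rfl
  · intro n x hx
    split_ifs with h
    · refine div_le_radialMajorant hk0 hδk hε0 hR0 hC (norm_nonneg _) (hW1 _) (fun hp => ?_) h
        ((abs_norm_sub_norm_le _ _).trans hx)
      have hne : n - m ≠ 0 := fun h0 => by
        rw [sub_eq_zero.1 h0] at h
        linarith
      have hp0 : 0 < ‖latticePt L n‖ := by linarith
      have hge : ‖latticePt L n‖ / 2 ≤ ‖latticePt L (n - m)‖ := by
        rw [latticePt_sub]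
        linarith [norm_sub_norm_le (latticePt L n) (latticePt L m)]
      refine (hW2 _ hne).trans ?_
      rw [hℓR]
      calc C / (R⁻¹ ^ 2 * ‖latticePt L (n - m)‖ ^ 2)
          ≤ C / (R⁻¹ ^ 2 * (‖latticePt L n‖ / 2) ^ 2) := by gcongr
        _ = 4 * C * R ^ 2 / ‖latticePt L n‖ ^ 2 := by
            field_simp
            norm_num
    · exact div_nonneg (mul_nonneg hC (radialMajorant_nonneg hk0 hε0 hR0 _)) (sq_nonneg _)
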